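/- Let 𝒢 be a finite connected graph with distance d, let r', r'' ≥ ℓ ≥ 0 be integers, q ∈ (0,1), and let u', u'' ∈ 𝒢 with d(u',u'') ≥ r' + r'' + 2 and B_{r'}(u'), B_{r''}(u'') ⊊ 𝒢. Let f : 𝒢 × 𝒢 → [0,∞) be such that for every fixed y ∈ 𝒢 the function x ↦ f(x,y) is (ℓ,q)-subharmonic in B_{r'}(u'), and for every fixed x ∈ 𝒢 the function y ↦ f(x,y) is (ℓ,q)-subharmonic in B_{r''}(u''). Then f(u',u'') ≤ q^{⌊(r'+1)/(ℓ+1)⌋ + ⌊(r''+1)/(ℓ+1)⌋}·ℳ(f, 𝒢×𝒢) ≤ q^{(r'+r''−2ℓ)/(ℓ+1)}·ℳ(f, 𝒢×𝒢). -/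

import Mathlib

/-!
Statement 2: two-variable subharmonic decay (Lemma `subh.2` in the paper).
-/

open Finset

section Defs

variable {Gv : Type*} [Fintype Gv]

/-- The ball `B_r(x) = {y : d(x,y) ≤ r}` of the graph metric, as a `Finset`. -/
noncomputable def gball (G : SimpleGraph Gv) (x : Gv) (r : ℕ) : Finset Gv :=
  Finset.univ.filter (fun y => G.dist x y ≤ r)

lemma self_mem_gball (G : SimpleGraph Gv) (x : Gv) (r : ℕ) : x ∈ gball G x r := by
  simp [gball, SimpleGraph.dist_self]

/-- `max_{y ∈ B_r(x)} f(y)`. -/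
noncomputable def ballMax (G : SimpleGraph Gv) (f : Gv → ℝ) (x : Gv) (r : ℕ) : ℝ :=
  (gball G x r).sup' ⟨x, self_mem_gball G x r⟩ f

/-- `f` is `(ℓ,q)`-subharmonic in the ball `B_L(u)`. -/
def IsSubharmonic (G : SimpleGraph Gv) (f : Gv → ℝ) (ℓ : ℕ) (q : ℝ) (u : Gv) (L : ℕ) : Prop :=
  ∀ x : Gv, gball G x ℓ ⊆ gball G u L → f x ≤ q * ballMax G f x (ℓ + 1)

end Defs

lemma mem_gball {Gv : Type*} [Fintype Gv] {G : SimpleGraph Gv} {x y : Gv} {r : ℕ} :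
    y ∈ gball G x r ↔ G.dist x y ≤ r := by
  simp [gball]

lemma IsSubharmonic.le_pow_mul_of_dist_add_le {Gv : Type*} [Fintype Gv] {G : SimpleGraph Gv}
    (hconn : G.Connected) {f : Gv → ℝ} {ℓ L : ℕ} {q M : ℝ} {u : Gv} (hq : 0 ≤ q)
    (hf : IsSubharmonic G f ℓ q u L) (hM : ∀ x, f x ≤ M) (k : ℕ) {x : Gv}
    (hx : G.dist u x + k * (ℓ + 1) ≤ L + 1) : f x ≤ q ^ k * M := by
  induction k generalizing x with
  | zero => simpa using hM x
  | succ k ih =>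
    rw [Nat.succ_mul] at hx
    have hball : gball G x ℓ ⊆ gball G u L := fun y hy => by
      rw [mem_gball] at hy ⊢
      have := hconn.dist_triangle (u := u) (v := x) (w := y)
      omega
    refine (hf x hball).trans ?_
    rw [pow_succ', mul_assoc]
    refine mul_le_mul_of_nonneg_left (Finset.sup'_le _ _ fun y hy => ih ?_) hq
    rw [mem_gball] at hy
    have := hconn.dist_triangle (u := u) (v := x) (w := y)
    omega

lemma IsSubharmonic.le_pow_mul {Gv : Type*} [Fintype Gv] {G : SimpleGraph Gv}
    (hconn : G.Connected) {f : Gv → ℝ} {ℓ L : ℕ} {q M : ℝ} {u : Gv} (hq : 0 ≤ q)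
    (hf : IsSubharmonic G f ℓ q u L) (hM : ∀ x, f x ≤ M) :
    f u ≤ q ^ ((L + 1) / (ℓ + 1)) * M :=
  hf.le_pow_mul_of_dist_add_le hconn hq hM _ (by
    simpa [SimpleGraph.dist_self] using Nat.div_mul_le_self (L + 1) (ℓ + 1))

lemma sub_div_le_natCast_div (r ℓ : ℕ) :
    ((r : ℝ) - ℓ) / (ℓ + 1) ≤ ((r + 1) / (ℓ + 1) : ℕ) := by
  rw [div_le_iff₀ (by positivity)]
  have h : r + 1 < (ℓ + 1) * ((r + 1) / (ℓ + 1) + 1) := Nat.lt_mul_div_succ _ ℓ.succ_pos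
  have h2 : (r : ℝ) + 1 < (ℓ + 1) * (((r + 1) / (ℓ + 1) : ℕ) + 1) := by exact_mod_cast h
  linarith

theorem statement2 {Gv : Type*} [Fintype Gv] (G : SimpleGraph Gv) (hconn : G.Connected)
    (ℓ r' r'' : ℕ) (h' : ℓ ≤ r') (h'' : ℓ ≤ r'')
    (q : ℝ) (hq0 : 0 < q) (hq1 : q < 1)
    (u' u'' : Gv) (hdist : r' + r'' + 2 ≤ G.dist u' u'')
    (hp' : gball G u' r' ≠ Finset.univ) (hp'' : gball G u'' r'' ≠ Finset.univ)
    (f : Gv → Gv → ℝ) (hf : ∀ x y, 0 ≤ f x y)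
    (hsub1 : ∀ y : Gv, IsSubharmonic G (fun x => f x y) ℓ q u' r')
    (hsub2 : ∀ x : Gv, IsSubharmonic G (fun y => f x y) ℓ q u'' r'') :
    f u' u'' ≤ q ^ ((r' + 1) / (ℓ + 1) + (r'' + 1) / (ℓ + 1)) *
        Finset.univ.sup' ⟨u', Finset.mem_univ u'⟩
          (fun v => Finset.univ.sup' ⟨u'', Finset.mem_univ u''⟩ (fun w => f v w)) ∧
      f u' u'' ≤ q ^ ((((r' : ℝ) + (r'' : ℝ) - 2 * (ℓ : ℝ)) / ((ℓ : ℝ) + 1))) *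
        Finset.univ.sup' ⟨u', Finset.mem_univ u'⟩
          (fun v => Finset.univ.sup' ⟨u'', Finset.mem_univ u''⟩ (fun w => f v w)) := by
  set M := Finset.univ.sup' ⟨u', Finset.mem_univ u'⟩
    (fun v => Finset.univ.sup' ⟨u'', Finset.mem_univ u''⟩ (fun w => f v w))
  have hM (x y : Gv) : f x y ≤ M :=
    (Finset.le_sup' (fun w => f x w) (Finset.mem_univ y)).trans
      (Finset.le_sup' (fun v => Finset.univ.sup' ⟨u'', Finset.mem_univ u''⟩ (fun w => f v w))
        (Finset.mem_univ x))
  have hM0 : 0 ≤ M := (hf u' u'').trans (hM u' u'')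
  have key : f u' u'' ≤ q ^ ((r' + 1) / (ℓ + 1) + (r'' + 1) / (ℓ + 1)) * M := by
    rw [add_comm, pow_add, mul_assoc]
    exact (hsub2 u').le_pow_mul hconn hq0.le fun y =>
      (hsub1 y).le_pow_mul (f := fun x => f x y) hconn hq0.le fun x => hM x y
  refine ⟨key, key.trans (mul_le_mul_of_nonneg_right ?_ hM0)⟩
  rw [← Real.rpow_natCast]
  refine Real.rpow_le_rpow_of_exponent_ge hq0 hq1.le ?_
  have hsum := add_le_add (sub_div_le_natCast_div r' ℓ) (sub_div_le_natCast_div r'' ℓ)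
  rw [← add_div] at hsum
  rw [Nat.cast_add]
  exact le_of_eq_of_le (by ring) hsum
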